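/- Let A and C be unital C*-algebras, let X be a complex Banach space, let ε > 0, and let F : A × C → X be Fréchet ℂ-differentiable on the open set H₊(A) × H₊(C). If F vanishes on (iε·1 + A_sa) × (iε·1 + C_sa), then F vanishes identically on H₊(A) × H₊(C). -/

import Mathlib

/-- The imaginary part `Im T := (T - T*)/(2i)` of an element of a C*-algebra. -/
noncomputable def cstarIm {A : Type*} [CStarAlgebra A] (T : A) : A :=
  ((2 * Complex.I)⁻¹ : ℂ) • (T - star T)

/-- The upper half-plane `H₊(A) = {T : Im T ≥ δ • 1 for some δ > 0}`. -/
def upperHalfPlaneCStar (A : Type*) [CStarAlgebra A] [PartialOrder A] : Set A :=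
  {T : A | ∃ δ : ℝ, 0 < δ ∧ δ • (1 : A) ≤ cstarIm T}

section UpperHalfPlane

variable {A : Type*} [CStarAlgebra A]

theorem isSelfAdjoint_cstarIm (T : A) : IsSelfAdjoint (cstarIm T) := by
  rw [IsSelfAdjoint, cstarIm, star_smul, star_sub, star_star, ← neg_sub T, smul_neg, ← neg_smul]
  simp

theorem continuous_cstarIm : Continuous (cstarIm : A → A) := by
  unfold cstarIm
  fun_prop

theorem cstarIm_add (S T : A) : cstarIm (S + T) = cstarIm S + cstarIm T := by
  simp only [cstarIm, star_add, ← smul_add]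
  congr 1
  abel

theorem cstarIm_real_smul (r : ℝ) (T : A) : cstarIm (r • T) = r • cstarIm T := by
  simp only [cstarIm, star_smul, star_trivial, ← smul_sub]
  rw [smul_comm]

theorem realPart_add_I_smul_cstarIm (T : A) :
    (realPart T : A) + Complex.I • cstarIm T = T := by
  have h : cstarIm T = (imaginaryPart T : A) := by
    rw [imaginaryPart_apply_coe, cstarIm, ← Complex.coe_smul, smul_smul]
    congr 1
    simp [mul_comm]
  rw [h, realPart_add_I_smul_imaginaryPart]

theorem cstarIm_mul_I_smul_one_add {a : A} (ha : IsSelfAdjoint a) (ε : ℝ) :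
    cstarIm (((ε : ℂ) * Complex.I) • (1 : A) + a) = ε • (1 : A) := by
  rw [cstarIm, star_add, ha.star_eq, star_smul, star_one, add_sub_add_right_eq_sub, ← sub_smul,
    smul_smul, ← Complex.coe_smul]
  congr 1
  simp only [Complex.star_def, map_mul, Complex.conj_ofReal, Complex.conj_I]
  field_simp
  ring

/-- The complex affine line through `iε + Re T` (at `0`) and `T` (at `i`). -/
noncomputable def shiftedLine (ε : ℝ) (T : A) : ℂ →ᵃ[ℝ] A :=
  AffineMap.const ℝ ℂ (((ε : ℂ) * Complex.I) • (1 : A) + (realPart T : A)) +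
    ((LinearMap.toSpanSingleton ℂ A (cstarIm T - ε • (1 : A))).restrictScalars ℝ).toAffineMap

theorem shiftedLine_apply (ε : ℝ) (T : A) (z : ℂ) :
    shiftedLine ε T z =
      ((ε : ℂ) * Complex.I) • (1 : A) + ((realPart T : A) + z • (cstarIm T - ε • (1 : A))) :=
  add_assoc _ _ _

theorem shiftedLine_I (ε : ℝ) (T : A) : shiftedLine ε T Complex.I = T := by
  rw [shiftedLine_apply, smul_sub, ← Complex.coe_smul, smul_smul, mul_comm (ε : ℂ)]
  conv_rhs => rw [← realPart_add_I_smul_cstarIm T]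
  abel

theorem differentiable_shiftedLine (ε : ℝ) (T : A) : Differentiable ℂ (shiftedLine ε T) := by
  simp only [funext (shiftedLine_apply ε T)]
  fun_prop

theorem isSelfAdjoint_realPart_add_real_smul (ε : ℝ) (T : A) (x : ℝ) :
    IsSelfAdjoint ((realPart T : A) + (x : ℂ) • (cstarIm T - ε • (1 : A))) := by
  rw [Complex.coe_smul]
  exact (realPart T).2.add
    (.smul (.all x) ((isSelfAdjoint_cstarIm T).sub (.smul (.all ε) (.one A))))

variable [PartialOrder A]

theorem convex_upperHalfPlaneCStar [StarOrderedRing A] :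
    Convex ℝ (upperHalfPlaneCStar A) := by
  refine convex_iff_forall_pos.mpr ?_
  rintro S ⟨δ, hδ, hS⟩ T ⟨η, hη, hT⟩ s t hs ht -
  refine ⟨s * δ + t * η, by positivity, ?_⟩
  rw [cstarIm_add, cstarIm_real_smul, cstarIm_real_smul, add_smul, mul_smul, mul_smul]
  gcongr

theorem isOpen_upperHalfPlaneCStar [StarOrderedRing A] :
    IsOpen (upperHalfPlaneCStar A) := by
  rw [isOpen_iff_mem_nhds]
  rintro T ⟨δ, hδ, hT⟩
  have hnear := continuous_cstarIm.continuousAt.eventually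
    (Metric.ball_mem_nhds (cstarIm T) (half_pos hδ))
  filter_upwards [hnear] with S hS
  refine ⟨δ / 2, half_pos hδ, ?_⟩
  rw [dist_eq_norm] at hS
  have hsub := ((isSelfAdjoint_cstarIm S).sub (isSelfAdjoint_cstarIm T)).neg_algebraMap_norm_le_self
  rw [Algebra.algebraMap_eq_smul_one] at hsub
  have hle : ‖cstarIm S - cstarIm T‖ • (1 : A) ≤ (δ / 2) • (1 : A) :=
    smul_le_smul_of_nonneg_right hS.le zero_le_one
  calc (δ / 2) • (1 : A) = δ • (1 : A) + -((δ / 2) • (1 : A)) := by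
        rw [← neg_smul, ← add_smul]; congr 1; ring
    _ ≤ cstarIm T + (cstarIm S - cstarIm T) :=
        add_le_add hT ((neg_le_neg hle).trans hsub)
    _ = cstarIm S := by abel

theorem mul_I_smul_one_add_mem_upperHalfPlaneCStar {a : A} (ha : IsSelfAdjoint a) {ε : ℝ}
    (hε : 0 < ε) : ((ε : ℂ) * Complex.I) • (1 : A) + a ∈ upperHalfPlaneCStar A :=
  ⟨ε, hε, (cstarIm_mul_I_smul_one_add ha ε).ge⟩

end UpperHalfPlane

/-- Two-variable uniqueness-set statement used in the proof of Proposition 3.3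
of the paper: a Banach-space valued function, holomorphic on
`H₊(A) × H₊(C)` and vanishing on `(iε·1 + A_sa) × (iε·1 + C_sa)`, vanishes
identically on `H₊(A) × H₊(C)`. -/
theorem eqOn_zero_of_holomorphic_vanishing_on_shifted_selfAdjoint_prod
    {A : Type*} [CStarAlgebra A] [PartialOrder A] [StarOrderedRing A] [Nontrivial A]
    {C : Type*} [CStarAlgebra C] [PartialOrder C] [StarOrderedRing C] [Nontrivial C]
    {X : Type*} [NormedAddCommGroup X] [NormedSpace ℂ X]
    (ε : ℝ) (hε : 0 < ε) (F : A × C → X)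
    (hF : DifferentiableOn ℂ F (upperHalfPlaneCStar A ×ˢ upperHalfPlaneCStar C))
    (hvan : ∀ a : A, ∀ c : C, IsSelfAdjoint a → IsSelfAdjoint c →
      F (((ε : ℂ) * Complex.I) • (1 : A) + a,
         ((ε : ℂ) * Complex.I) • (1 : C) + c) = 0) :
    ∀ p ∈ upperHalfPlaneCStar A ×ˢ upperHalfPlaneCStar C, F p = 0 := by
  rintro ⟨T, S⟩ ⟨hT, hS⟩
  refine SeparatingDual.eq_zero_of_forall_dual_eq_zero (R := ℂ) fun φ => ?_
  let L : ℂ →ᵃ[ℝ] A × C := (shiftedLine ε T).prod (shiftedLine ε S)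
  have hL : Differentiable ℂ L :=
    (differentiable_shiftedLine ε T).prodMk (differentiable_shiftedLine ε S)
  let U : Set ℂ := L ⁻¹' (upperHalfPlaneCStar A ×ˢ upperHalfPlaneCStar C)
  have hUo : IsOpen U :=
    (isOpen_upperHalfPlaneCStar.prod isOpen_upperHalfPlaneCStar).preimage hL.continuous
  have hUc : Convex ℝ U :=
    (convex_upperHalfPlaneCStar.prod convex_upperHalfPlaneCStar).affine_preimage L
  have hLI : L Complex.I = (T, S) := Prod.ext (shiftedLine_I ε T) (shiftedLine_I ε S)
  have hUI : Complex.I ∈ U := by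
    rw [Set.mem_preimage, hLI]
    exact ⟨hT, hS⟩
  have hL_real (x : ℝ) : L x =
      (((ε : ℂ) * Complex.I) • (1 : A) + ((realPart T : A) + (x : ℂ) • (cstarIm T - ε • (1 : A))),
        ((ε : ℂ) * Complex.I) • (1 : C) +
          ((realPart S : C) + (x : ℂ) • (cstarIm S - ε • (1 : C)))) :=
    Prod.ext (shiftedLine_apply ε T x) (shiftedLine_apply ε S x)
  have hU0 : ((0 : ℝ) : ℂ) ∈ U := by
    rw [Set.mem_preimage, hL_real]
    exact ⟨mul_I_smul_one_add_mem_upperHalfPlaneCStar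
        (isSelfAdjoint_realPart_add_real_smul ε T 0) hε,
      mul_I_smul_one_add_mem_upperHalfPlaneCStar
        (isSelfAdjoint_realPart_add_real_smul ε S 0) hε⟩
  have hg : DifferentiableOn ℂ (fun z => φ (F (L z))) U :=
    φ.differentiable.comp_differentiableOn
      (hF.comp hL.differentiableOn (Set.mapsTo_preimage _ _))
  have hg_real (x : ℝ) : φ (F (L x)) = 0 := by
    rw [hL_real, hvan _ _ (isSelfAdjoint_realPart_add_real_smul ε T x)
      (isSelfAdjoint_realPart_add_real_smul ε S x), map_zero]
  have hofReal : Filter.Tendsto ((↑) : ℝ → ℂ) (nhdsWithin 0 {0}ᶜ)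
      (nhdsWithin ((0 : ℝ) : ℂ) {((0 : ℝ) : ℂ)}ᶜ) :=
    Complex.continuous_ofReal.continuousAt.continuousWithinAt.tendsto_nhdsWithin
      fun x hx => by simpa using hx
  have hfreq : ∃ᶠ z in nhdsWithin ((0 : ℝ) : ℂ) {((0 : ℝ) : ℂ)}ᶜ, φ (F (L z)) = 0 :=
    hofReal.frequently (Filter.Frequently.of_forall hg_real)
  have hzero := (hg.analyticOnNhd hUo).eqOn_zero_of_preconnected_of_frequently_eq_zero
    hUc.isPreconnected hU0 hfreq hUI
  simpa [hLI] using hzero
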